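/- arXiv:math-ph/0512033 — 2 statements merged into one kernel-verified Lean document; each statement's English description precedes it below -/
import Mathlib

section
/- Let ℳ_∞ = { A(x) ∈ M(r,d) : det D(A(x); ∞) ≠ 0 } and let 𝒮_∞ be the set of A(x) ∈ M(r,d) such that, in block notation, the coefficient T_d of x^d in T(x) equals τ, the coefficient u_{d−1} of x^{d−1} in u(x) equals ν, and the first row of the coefficient T_{d−1} of x^{d−1} in T(x) is zero. Then the map 𝒮_∞ × G_r → ℳ_∞ sending (S(x), g(x)) to g(x)⁻¹S(x)g(x) is well defined (the image lies in ℳ_∞) and is a bijection. -/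
open Polynomial Matrix

noncomputable section

/-- The space `M(r,d)` of polynomial matrices, with `r = n+2`. -/
def Mrd (n d : ℕ) (A : Matrix (Fin (n+2)) (Fin (n+2)) (Polynomial ℂ)) : Prop :=
  (A 0 0).degree ≤ (d : WithBot ℕ) ∧
  (∀ j : Fin (n+1), (A 0 j.succ).degree ≤ ((d+1 : ℕ) : WithBot ℕ)) ∧
  (∀ i : Fin (n+1), (A i.succ 0).degree ≤ ((d-1 : ℕ) : WithBot ℕ)) ∧
  (∀ i j : Fin (n+1), (A i.succ j.succ).degree ≤ (d : WithBot ℕ))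

/-- The group `G_r`, `r = n+2`: block form `[[1, ᵗb₁x + ᵗb₀],[0, B]]` with `B ∈ GL_{r-1}(ℂ)`. -/
def Gr (n : ℕ) (g : Matrix (Fin (n+2)) (Fin (n+2)) (Polynomial ℂ)) : Prop :=
  g 0 0 = 1 ∧
  (∀ i : Fin (n+1), g i.succ 0 = 0) ∧
  (∀ j : Fin (n+1), (g 0 j.succ).degree ≤ 1) ∧
  (∀ i j : Fin (n+1), (g i.succ j.succ).degree ≤ 0) ∧
  IsUnit g.det

/-- The block `u(x)` of `A(x)`. -/
def blkU (n : ℕ) (A : Matrix (Fin (n+2)) (Fin (n+2)) (Polynomial ℂ)) :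
    Fin (n+1) → Polynomial ℂ := fun i => A i.succ 0

/-- The block `T(x)` of `A(x)`. -/
def blkT (n : ℕ) (A : Matrix (Fin (n+2)) (Fin (n+2)) (Polynomial ℂ)) :
    Matrix (Fin (n+1)) (Fin (n+1)) (Polynomial ℂ) := Matrix.of fun i j => A i.succ j.succ

/-- `D(A(x); x) = (u(x), T(x)u(x), …, T(x)^{r−2}u(x))`. -/
def Dmat (n : ℕ) (A : Matrix (Fin (n+2)) (Fin (n+2)) (Polynomial ℂ)) :
    Matrix (Fin (n+1)) (Fin (n+1)) (Polynomial ℂ) :=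
  Matrix.of fun i j => ((blkT n A ^ (j : ℕ)) *ᵥ blkU n A) i

/-- `D(A(x); c)`, evaluation at `x = c`. -/
def Dc (n : ℕ) (A : Matrix (Fin (n+2)) (Fin (n+2)) (Polynomial ℂ)) (c : ℂ) :
    Matrix (Fin (n+1)) (Fin (n+1)) ℂ :=
  (Dmat n A).map (eval c)

/-- The lower shift matrix `τ`. -/
def tauMat (n : ℕ) : Matrix (Fin (n+1)) (Fin (n+1)) ℂ :=
  Matrix.of fun i j => if (i : ℕ) = (j : ℕ) + 1 then 1 else 0

/-- The vector `ν = ᵗ(1,0,…,0)`. -/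
def nuVec (n : ℕ) : Fin (n+1) → ℂ := fun i => if (i : ℕ) = 0 then 1 else 0


/-- `D(A(x); ∞) = (u_{d−1}, T_d u_{d−1}, …, T_d^{r−2}u_{d−1})`, built from the coefficient
`u_{d−1}` of `x^{d−1}` in `u(x)` and the coefficient `T_d` of `x^d` in `T(x)`. -/
def Dinf (n d : ℕ) (A : Matrix (Fin (n+2)) (Fin (n+2)) (Polynomial ℂ)) :
    Matrix (Fin (n+1)) (Fin (n+1)) ℂ :=
  Matrix.of fun i j =>
    (((Matrix.of fun k l => (blkT n A k l).coeff d) ^ (j : ℕ)) *ᵥ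
      (fun k => (blkU n A k).coeff (d-1))) i

/-- `ℳ_∞ = { A(x) ∈ M(r,d) : det D(A(x); ∞) ≠ 0 }`. -/
def MemMinf (n d : ℕ) (A : Matrix (Fin (n+2)) (Fin (n+2)) (Polynomial ℂ)) : Prop :=
  Mrd n d A ∧ (Dinf n d A).det ≠ 0

/-- `𝒮_∞`: the coefficient `T_d` of `x^d` in `T(x)` is `τ`, the coefficient `u_{d−1}` of
`x^{d−1}` in `u(x)` is `ν`, and the first row of the coefficient `T_{d−1}` of `x^{d−1}`
in `T(x)` vanishes. -/
def MemSinf (n d : ℕ) (A : Matrix (Fin (n+2)) (Fin (n+2)) (Polynomial ℂ)) : Prop :=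
  Mrd n d A ∧
  (∀ i j : Fin (n+1), (blkT n A i j).coeff d = tauMat n i j) ∧
  (∀ i : Fin (n+1), (blkU n A i).coeff (d-1) = nuVec n i) ∧
  (∀ j : Fin (n+1), (blkT n A 0 j).coeff (d-1) = 0)

namespace Stmt2

abbrev PM (n : ℕ) := Matrix (Fin (n+2)) (Fin (n+2)) (Polynomial ℂ)

/-- weight: `1` on the first index, `0` elsewhere. -/
def wt {n : ℕ} (i : Fin (n+2)) : ℕ := if i = 0 then 1 else 0

lemma wt_zero {n : ℕ} : wt (0 : Fin (n+2)) = 1 := by simp [wt]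
lemma wt_succ {n : ℕ} (i : Fin (n+1)) : wt (i.succ) = 0 := by simp [wt, Fin.succ_ne_zero]

/-- weighted degree filtration -/
def Filt {n : ℕ} (m : ℕ) (A : PM n) : Prop :=
  ∀ i j k, m + wt i < k + wt j → (A i j).coeff k = 0

lemma Filt.mul {n m m' : ℕ} {A B : PM n} (hA : Filt m A) (hB : Filt m' B) :
    Filt (m + m') (A * B) := by
  intro i j k hk
  rw [Matrix.mul_apply, finsetSum_coeff]
  refine Finset.sum_eq_zero fun l _ => ?_
  rw [coeff_mul]
  refine Finset.sum_eq_zero fun p hp => ?_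
  have hp' := Finset.HasAntidiagonal.mem_antidiagonal.1 hp
  by_cases h : m + wt i < p.1 + wt l
  · rw [hA i l _ h, zero_mul]
  · rw [hB l j _ (by omega), mul_zero]

lemma mrd_iff {n d : ℕ} (hd : 1 ≤ d) (A : PM n) : Mrd n d A ↔ Filt d A := by
  constructor
  · rintro ⟨h1, h2, h3, h4⟩ i j k hk
    refine Fin.cases ?_ (fun i => ?_) i hk <;> refine Fin.cases ?_ (fun j => ?_) j
    · intro hk; simp only [wt_zero, wt_succ] at hk
      exact (degree_le_iff_coeff_zero _ _).1 h1 k (by exact_mod_cast (by omega : d < k))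
    · intro hk; simp only [wt_zero, wt_succ] at hk
      exact (degree_le_iff_coeff_zero _ _).1 (h2 j) k (by exact_mod_cast (by omega : d + 1 < k))
    · intro hk; simp only [wt_zero, wt_succ] at hk
      exact (degree_le_iff_coeff_zero _ _).1 (h3 i) k (by exact_mod_cast (by omega : d - 1 < k))
    · intro hk; simp only [wt_succ] at hk
      exact (degree_le_iff_coeff_zero _ _).1 (h4 i j) k (by exact_mod_cast (by omega : d < k))
  · intro h
    refine ⟨?_, fun j => ?_, fun i => ?_, fun i j => ?_⟩ <;>
      refine (degree_le_iff_coeff_zero _ _).2 fun k hk => h _ _ _ ?_ <;>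
      simp only [wt_zero, wt_succ] <;> norm_cast at hk <;> omega

/-- the element of `G_r` with blocks `B`, `b₀`, `b₁`. -/
def mkG {n : ℕ} (B : Matrix (Fin (n+1)) (Fin (n+1)) ℂ) (b0 b1 : Fin (n+1) → ℂ) : PM n :=
  fun i => Fin.cases (motive := fun _ => Fin (n+2) → ℂ[X])
    (fun j => Fin.cases (motive := fun _ => ℂ[X]) 1 (fun j => C (b1 j) * X + C (b0 j)) j)
    (fun i j => Fin.cases (motive := fun _ => ℂ[X]) 0 (fun j => C (B i j)) j) i

section
variable {n : ℕ} (B : Matrix (Fin (n+1)) (Fin (n+1)) ℂ) (b0 b1 : Fin (n+1) → ℂ)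

@[simp] lemma mkG_00 : mkG B b0 b1 0 0 = 1 := rfl
@[simp] lemma mkG_0s (j : Fin (n+1)) : mkG B b0 b1 0 j.succ = C (b1 j) * X + C (b0 j) := rfl
@[simp] lemma mkG_s0 (i : Fin (n+1)) : mkG B b0 b1 i.succ 0 = 0 := rfl
@[simp] lemma mkG_ss (i j : Fin (n+1)) : mkG B b0 b1 i.succ j.succ = C (B i j) := rfl

lemma mkG_det : (mkG B b0 b1).det = C B.det := by
  rw [Matrix.det_succ_column_zero, Fin.sum_univ_succ]
  simp only [mkG_s0, mul_zero, zero_mul, Finset.sum_const_zero, add_zero, mkG_00]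
  rw [RingHom.map_det]
  simp only [Fin.val_zero, pow_zero, one_mul]
  congr 1

lemma mkG_gr (h : B.det ≠ 0) : Gr n (mkG B b0 b1) := by
  refine ⟨rfl, fun i => rfl, fun j => ?_, fun i j => ?_, ?_⟩
  · rw [mkG_0s]; exact degree_linear_le
  · rw [mkG_ss]; exact degree_C_le
  · rw [mkG_det]; exact isUnit_C.2 (isUnit_iff_ne_zero.2 h)

lemma mkG_filt : Filt 0 (mkG B b0 b1) := by
  intro i j k
  refine Fin.cases ?_ (fun i => ?_) i <;> refine Fin.cases ?_ (fun j => ?_) j <;>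
    intro hk <;> simp only [wt_zero, wt_succ] at hk
  · rw [mkG_00, coeff_one, if_neg (by omega)]
  · rw [mkG_0s, coeff_add, coeff_C_mul, coeff_X, coeff_C, if_neg (by omega), if_neg (by omega)]
    simp
  · simp
  · rw [mkG_ss, coeff_C, if_neg (by omega)]

lemma mkG_mul (B' : Matrix (Fin (n+1)) (Fin (n+1)) ℂ) (b0' b1' : Fin (n+1) → ℂ) :
    mkG B b0 b1 * mkG B' b0' b1' = mkG (B * B') (b0' + b0 ᵥ* B') (b1' + b1 ᵥ* B') := by
  ext1 i j
  rw [Matrix.mul_apply, Fin.sum_univ_succ]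
  refine Fin.cases ?_ (fun i => ?_) i <;> refine Fin.cases ?_ (fun j => ?_) j
  · simp
  · simp only [mkG_00, mkG_0s, mkG_ss, Pi.add_apply, Matrix.vecMul, dotProduct, map_add, map_sum,
      map_mul, add_mul, Finset.sum_add_distrib, Finset.sum_mul, one_mul]
    have : ∀ x : Fin (n+1), C (b1 x) * X * C (B' x j) = C (b1 x) * C (B' x j) * X := 
      fun x => by ring
    simp only [this]
    ring
  · simp
  · simp [Matrix.mul_apply]

lemma mkG_one : mkG (1 : Matrix (Fin (n+1)) (Fin (n+1)) ℂ) 0 0 = 1 := by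
  ext1 i j
  refine Fin.cases ?_ (fun i => ?_) i <;> refine Fin.cases ?_ (fun j => ?_) j
  · simp
  · simp [Matrix.one_apply, (Fin.succ_ne_zero j).symm]
  · simp [Matrix.one_apply]
  · simp [Matrix.one_apply, apply_ite]

lemma mkG_inv (h : B.det ≠ 0) :
    (mkG B b0 b1)⁻¹ = mkG B⁻¹ (-(b0 ᵥ* B⁻¹)) (-(b1 ᵥ* B⁻¹)) := by
  apply Matrix.inv_eq_right_inv
  rw [mkG_mul, Matrix.mul_nonsing_inv _ (isUnit_iff_ne_zero.2 h)]
  simp [mkG_one]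

lemma mkG_inv_filt (h : B.det ≠ 0) : Filt 0 (mkG B b0 b1)⁻¹ := by
  rw [mkG_inv _ _ _ h]; exact mkG_filt _ _ _

end

lemma gr_mkG {n : ℕ} {g : PM n} (hg : Gr n g) :
    ∃ B b0 b1, B.det ≠ 0 ∧ g = mkG B b0 b1 := by
  obtain ⟨h1, h2, h3, h4, h5⟩ := hg
  have key : g = mkG (Matrix.of fun i j => (g i.succ j.succ).coeff 0)
      (fun j => (g 0 j.succ).coeff 0) (fun j => (g 0 j.succ).coeff 1) := by
    ext1 i j
    refine Fin.cases ?_ (fun i => ?_) i <;> refine Fin.cases ?_ (fun j => ?_) j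
    · simp [h1]
    · rw [mkG_0s]; exact eq_X_add_C_of_degree_le_one (h3 j)
    · simp [h2]
    · rw [mkG_ss]; exact eq_C_of_degree_le_zero (h4 i j)
  refine ⟨_, _, _, ?_, key⟩
  rw [key, mkG_det, isUnit_C] at h5
  exact h5.ne_zero

/-- Krylov matrix -/
def Kry {n : ℕ} (T : Matrix (Fin (n+1)) (Fin (n+1)) ℂ) (u : Fin (n+1) → ℂ) :
    Matrix (Fin (n+1)) (Fin (n+1)) ℂ := Matrix.of fun i j => ((T ^ (j : ℕ)) *ᵥ u) i

lemma row_pow {n : ℕ} {T B : Matrix (Fin (n+1)) (Fin (n+1)) ℂ}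
    (h : ∀ i : Fin n, B i.succ ᵥ* T = B i.castSucc) (k : ℕ) :
    ∀ i : Fin (n+1), (hk : k ≤ i) → B i ᵥ* T ^ k = B ⟨i - k, by omega⟩ := by
  induction k with
  | zero => intro i _; simp
  | succ k ih =>
    intro i hk
    rw [pow_succ, ← Matrix.vecMul_vecMul, ih i (by omega)]
    have := h ⟨i - k - 1, by omega⟩
    have e1 : (⟨i - k, by omega⟩ : Fin (n+1)) = Fin.succ ⟨i - k - 1, by omega⟩ := by
      ext; simp; omega
    have e2 : (⟨i - (k + 1), by omega⟩ : Fin (n+1)) = Fin.castSucc ⟨i - k - 1, by omega⟩ := by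
      ext; simp; omega
    rw [e1, e2, this]

lemma mul_kry {n : ℕ} {T B : Matrix (Fin (n+1)) (Fin (n+1)) ℂ} {u : Fin (n+1) → ℂ}
    (h : ∀ i : Fin n, B i.succ ᵥ* T = B i.castSucc) (i k : Fin (n+1)) (hk : k ≤ i) :
    (B * Kry T u) i k = (B *ᵥ u) ⟨i - k, by omega⟩ := by
  have : (B * Kry T u) i k = B i ⬝ᵥ (T ^ (k : ℕ) *ᵥ u) := rfl
  rw [this, Matrix.dotProduct_mulVec, row_pow h k i hk]
  rfl

lemma det_kry {n : ℕ} {T B : Matrix (Fin (n+1)) (Fin (n+1)) ℂ} {u : Fin (n+1) → ℂ}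
    (h : ∀ i : Fin n, B i.succ ᵥ* T = B i.castSucc) (hu : B *ᵥ u = nuVec n) :
    B.det * (Kry T u).det = 1 := by
  rw [← Matrix.det_mul, Matrix.det_of_isUpperTriangular]
  · refine Finset.prod_eq_one fun i _ => ?_
    rw [mul_kry h i i le_rfl, hu]; simp [nuVec]
  · intro i k hk
    simp only [id] at hk
    rw [mul_kry h i k hk.le, hu, nuVec, if_neg]
    have : (k : ℕ) < i := hk
    simp; omega

lemma kry_unique {n : ℕ} {T E : Matrix (Fin (n+1)) (Fin (n+1)) ℂ} {u : Fin (n+1) → ℂ}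
    (h : ∀ i : Fin n, E i.succ ᵥ* T = E i.castSucc) (hu : E *ᵥ u = 0)
    (hK : (Kry T u).det ≠ 0) : E = 0 := by
  have h0 : E (Fin.last n) = 0 := by
    apply Matrix.eq_zero_of_vecMul_eq_zero hK
    ext k
    have := mul_kry (u := u) h (Fin.last n) k (Fin.le_last k)
    rw [hu] at this
    exact this
  have : ∀ i, E i = 0 := by
    intro i
    induction i using Fin.reverseInduction with
    | last => exact h0
    | cast i ih => rw [← h i, ih, Matrix.zero_vecMul]
  ext i j; rw [this i]; rfl

lemma kry_exists {n : ℕ} {T : Matrix (Fin (n+1)) (Fin (n+1)) ℂ} {u : Fin (n+1) → ℂ}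
    (hK : (Kry T u).det ≠ 0) : ∃ B : Matrix (Fin (n+1)) (Fin (n+1)) ℂ,
      (∀ i : Fin n, B i.succ ᵥ* T = B i.castSucc) ∧ B *ᵥ u = nuVec n := by
  set y : Fin (n+1) → ℂ := Pi.single (Fin.last n) 1 ᵥ* (Kry T u)⁻¹ with hy
  have hyK : y ᵥ* Kry T u = Pi.single (Fin.last n) 1 := by
    rw [hy, Matrix.vecMul_vecMul, Matrix.nonsing_inv_mul _ (isUnit_iff_ne_zero.2 hK),
      Matrix.vecMul_one]
  refine ⟨Matrix.of fun i => y ᵥ* T ^ (n - (i : ℕ)), fun i => ?_, ?_⟩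
  · change (y ᵥ* T ^ (n - ((i : ℕ) + 1))) ᵥ* T = y ᵥ* T ^ (n - (i : ℕ))
    rw [Matrix.vecMul_vecMul, ← pow_succ]
    congr 2; omega
  · ext i
    have h1 := congrFun hyK ⟨n - i, by omega⟩
    have h2 : (y ᵥ* Kry T u) ⟨n - i, by omega⟩ = y ⬝ᵥ (T ^ (n - (i : ℕ)) *ᵥ u) := rfl
    change (y ᵥ* T ^ (n - (i : ℕ))) ⬝ᵥ u = _
    rw [← Matrix.dotProduct_mulVec, ← h2, h1, Pi.single_apply, nuVec]
    congr 1
    simp only [Fin.ext_iff, Fin.val_last, eq_iff_iff]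
    omega

def Tco (n d : ℕ) (A : PM n) : Matrix (Fin (n+1)) (Fin (n+1)) ℂ :=
  Matrix.of fun k l => (blkT n A k l).coeff d
def Uco (n d : ℕ) (A : PM n) : Fin (n+1) → ℂ := fun k => (blkU n A k).coeff (d-1)

lemma Dinf_eq (n d : ℕ) (A : PM n) : Dinf n d A = Kry (Tco n d A) (Uco n d A) := rfl

section
variable {n : ℕ} {B : Matrix (Fin (n+1)) (Fin (n+1)) ℂ} {b0 b1 : Fin (n+1) → ℂ} {S A : PM n}

lemma rel_u (h : S * mkG B b0 b1 = mkG B b0 b1 * A) (i : Fin (n+1)) : S i.succ 0 = ∑ k, C (B i k) * A k.succ 0 := by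
  have := congrFun (congrFun h i.succ) 0
  rw [Matrix.mul_apply, Matrix.mul_apply, Fin.sum_univ_succ,
    Fin.sum_univ_succ (f := fun k => mkG B b0 b1 i.succ k * _)] at this
  simpa only [mkG_00, mkG_0s, mkG_s0, mkG_ss, mul_zero, zero_mul, mul_one, zero_add,
    Finset.sum_const_zero, add_zero] using this

lemma rel_T (h : S * mkG B b0 b1 = mkG B b0 b1 * A) (i j : Fin (n+1)) : S i.succ 0 * (C (b1 j) * X + C (b0 j)) +
    ∑ k : Fin (n+1), S i.succ k.succ * C (B k j) = ∑ k : Fin (n+1), C (B i k) * A k.succ j.succ := by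
  have := congrFun (congrFun h i.succ) j.succ
  rw [Matrix.mul_apply, Matrix.mul_apply, Fin.sum_univ_succ,
    Fin.sum_univ_succ (f := fun k => mkG B b0 b1 i.succ k * _)] at this
  simpa only [mkG_00, mkG_0s, mkG_s0, mkG_ss, mul_zero, zero_mul, mul_one, zero_add,
    Finset.sum_const_zero, add_zero] using this

lemma rel_uc (h : S * mkG B b0 b1 = mkG B b0 b1 * A) (d : ℕ) : Uco n d S = B *ᵥ Uco n d A := by
  ext i
  have := congrArg (fun p => p.coeff (d-1)) (rel_u h i)
  simpa [finsetSum_coeff, Matrix.mulVec, dotProduct, Uco, blkU] using this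

lemma rel_Tc (h : S * mkG B b0 b1 = mkG B b0 b1 * A) (k : ℕ) (i j : Fin (n+1)) :
    b1 j * (S i.succ 0 * X).coeff k + b0 j * (S i.succ 0).coeff k + (Tco n k S * B) i j
      = (B i ᵥ* Tco n k A) j := by
  have := congrArg (fun p => p.coeff k) (rel_T h i j)
  have e : S i.succ 0 * (C (b1 j) * X + C (b0 j)) =
    C (b1 j) * (S i.succ 0 * X) + C (b0 j) * S i.succ 0 := by ring
  rw [e] at this
  simpa only [coeff_add, coeff_C_mul, coeff_mul_C, finsetSum_coeff, Matrix.vecMul, dotProduct,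
    Tco, blkT, Matrix.mul_apply, Matrix.of_apply] using this

/-- top-degree relation -/
lemma rel_Td (h : S * mkG B b0 b1 = mkG B b0 b1 * A) {d : ℕ} (hd : 1 ≤ d) (hS : Filt d S) (i j : Fin (n+1)) :
    b1 j * Uco n d S i + (Tco n d S * B) i j = (B i ᵥ* Tco n d A) j := by
  rw [← rel_Tc h d i j, hS i.succ 0 d (by simp [wt_zero, wt_succ])]
  obtain ⟨d, rfl⟩ := Nat.exists_eq_add_of_le' hd
  rw [coeff_mul_X]
  simp [Uco, blkU]

end

lemma tau_mul_zero {n : ℕ} (B : Matrix (Fin (n+1)) (Fin (n+1)) ℂ) (j : Fin (n+1)) :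
    (tauMat n * B) 0 j = 0 := by
  simp [Matrix.mul_apply, tauMat]

lemma tau_mul_succ {n : ℕ} (B : Matrix (Fin (n+1)) (Fin (n+1)) ℂ) (i : Fin n) (j : Fin (n+1)) :
    (tauMat n * B) i.succ j = B i.castSucc j := by
  rw [Matrix.mul_apply, Finset.sum_eq_single i.castSucc]
  · simp [tauMat]
  · intro k _ hk
    simp only [tauMat, Matrix.of_apply]
    rw [if_neg, zero_mul]
    intro h
    apply hk
    ext
    simp at h ⊢; omega
  · simp

lemma mem_iff {n d : ℕ} (hd : 1 ≤ d) (S : PM n) : MemSinf n d S ↔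
    Filt d S ∧ Tco n d S = tauMat n ∧ Uco n d S = nuVec n ∧ ∀ j, Tco n (d-1) S 0 j = 0 := by
  rw [MemSinf, mrd_iff hd, funext_iff (f := Uco n d S), ← Matrix.ext_iff]
  rfl

lemma rel_rows {n d : ℕ} (hd : 1 ≤ d) {B : Matrix (Fin (n+1)) (Fin (n+1)) ℂ}
    {b0 b1 : Fin (n+1) → ℂ} {S A : PM n}
    (h : S * mkG B b0 b1 = mkG B b0 b1 * A) (hS : MemSinf n d S) :
    B *ᵥ Uco n d A = nuVec n ∧ (∀ i : Fin n, B i.succ ᵥ* Tco n d A = B i.castSucc) ∧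
    b1 = B 0 ᵥ* Tco n d A ∧
    ∀ j, b0 j = (B 0 ᵥ* Tco n (d-1) A) j
      - b1 j * ((∑ k, C (B 0 k) * A k.succ 0) * X).coeff (d-1) := by
  obtain ⟨hF, hT, hU, h0⟩ := (mem_iff hd S).1 hS
  refine ⟨by rw [← rel_uc h, hU], fun i => ?_, ?_, fun j => ?_⟩
  · ext j
    rw [← rel_Td h hd hF, hT, hU, tau_mul_succ]; simp [nuVec]
  · ext j
    rw [← rel_Td h hd hF, hT, hU, tau_mul_zero]; simp [nuVec]
  · rw [← rel_Tc h, rel_u h 0]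
    have e1 : (Tco n (d-1) S * B) 0 j = 0 := by
      simp [Matrix.mul_apply, h0]
    have e2 : (∑ k, C (B 0 k) * A k.succ 0).coeff (d-1) = 1 := by
      rw [← rel_u h 0]
      have := congrFun hU 0
      simpa [Uco, blkU, nuVec] using this
    rw [e1, e2]; ring

lemma conj_iff {n : ℕ} {S g A : PM n} (hg : IsUnit g.det) :
    g⁻¹ * S * g = A ↔ S * g = g * A := by
  constructor
  · rintro rfl
    rw [← Matrix.mul_assoc, ← Matrix.mul_assoc, Matrix.mul_nonsing_inv _ hg, Matrix.one_mul]
  · intro h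
    rw [Matrix.mul_assoc, h, ← Matrix.mul_assoc, Matrix.nonsing_inv_mul _ hg, Matrix.one_mul]

lemma wd {n d : ℕ} (hd : 1 ≤ d) (S g : PM n) (hS : MemSinf n d S) (hg : Gr n g) :
    MemMinf n d (g⁻¹ * S * g) := by
  have hu := hg.2.2.2.2
  obtain ⟨B, b0, b1, hB, rfl⟩ := gr_mkG hg
  have hF := ((mem_iff hd S).1 hS).1
  refine ⟨(mrd_iff hd _).2 ?_, ?_⟩
  · simpa using ((mkG_inv_filt B b0 b1 hB).mul hF).mul (mkG_filt B b0 b1)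
  · obtain ⟨h1, h2, -, -⟩ := rel_rows hd ((conj_iff hu).1 rfl) hS
    rw [Dinf_eq]
    exact right_ne_zero_of_mul (by rw [det_kry h2 h1]; exact one_ne_zero)

lemma uniq {n d : ℕ} (hd : 1 ≤ d) {A S g S' g' : PM n} (hA : MemMinf n d A)
    (hS : MemSinf n d S) (hg : Gr n g) (h : g⁻¹ * S * g = A)
    (hS' : MemSinf n d S') (hg' : Gr n g') (h' : g'⁻¹ * S' * g' = A) : S = S' ∧ g = g' := by
  have hu := hg.2.2.2.2
  rw [conj_iff hu] at h
  rw [conj_iff hg'.2.2.2.2] at h'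
  have hgg : g = g' := by
    clear hu
    obtain ⟨B, b0, b1, hB, rfl⟩ := gr_mkG hg
    obtain ⟨B', b0', b1', hB', rfl⟩ := gr_mkG hg'
    obtain ⟨r1, r2, r3, r4⟩ := rel_rows hd h hS
    obtain ⟨s1, s2, s3, s4⟩ := rel_rows hd h' hS'
    have hE : B - B' = 0 := by
      refine kry_unique (T := Tco n d A) (u := Uco n d A) (fun i => ?_) ?_ hA.2
      · change (B i.succ - B' i.succ) ᵥ* _ = B i.castSucc - B' i.castSucc
        rw [Matrix.sub_vecMul, r2, s2]
      · rw [Matrix.sub_mulVec, r1, s1, sub_self]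
    obtain rfl := sub_eq_zero.1 hE
    obtain rfl : b1 = b1' := r3.trans s3.symm
    obtain rfl : b0 = b0' := funext fun j => (r4 j).trans (s4 j).symm
    rfl
  subst hgg
  refine ⟨?_, rfl⟩
  have := h.trans h'.symm
  have := congrArg (· * g⁻¹) this
  simpa [Matrix.mul_assoc, Matrix.mul_nonsing_inv _ hu] using this

lemma exist {n d : ℕ} (hd : 1 ≤ d) {A : PM n} (hA : MemMinf n d A) :
    ∃ S g, MemSinf n d S ∧ Gr n g ∧ g⁻¹ * S * g = A := by
  have hK : (Kry (Tco n d A) (Uco n d A)).det ≠ 0 := hA.2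
  obtain ⟨B, h1, h2⟩ := kry_exists hK
  have hB : B.det ≠ 0 := left_ne_zero_of_mul (by rw [det_kry h1 h2]; exact one_ne_zero)
  set b1 := B 0 ᵥ* Tco n d A with hb1
  set b0 : Fin (n+1) → ℂ := fun j => (B 0 ᵥ* Tco n (d-1) A) j
      - b1 j * ((∑ k, C (B 0 k) * A k.succ 0) * X).coeff (d-1) with hb0
  have hg := mkG_gr B b0 b1 hB
  have hu := hg.2.2.2.2
  set g := mkG B b0 b1 with hgdef
  have hrel : (g * A * g⁻¹) * g = g * A := by
    rw [Matrix.mul_assoc, Matrix.nonsing_inv_mul _ hu, Matrix.mul_one]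
  refine ⟨g * A * g⁻¹, g, ?_, hg, (conj_iff hu).2 hrel⟩
  have hF : Filt d (g * A * g⁻¹) := by
    simpa using ((mkG_filt B b0 b1).mul ((mrd_iff hd A).1 hA.1)).mul (mkG_inv_filt B b0 b1 hB)
  generalize g * A * g⁻¹ = S at hrel hF
  have hU : Uco n d S = nuVec n := by rw [rel_uc hrel, h2]
  have hc : ∀ {M N : Matrix (Fin (n+1)) (Fin (n+1)) ℂ}, M * B = N * B → M = N := by
    intro M N h
    have := congrArg (· * B⁻¹) h
    simpa [Matrix.mul_assoc, Matrix.mul_nonsing_inv _ (isUnit_iff_ne_zero.2 hB)] using this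
  refine (mem_iff hd S).2 ⟨hF, hc ?_, hU, ?_⟩
  · ext i j
    have := rel_Td hrel hd hF i j
    rw [hU] at this
    refine Fin.cases ?_ (fun i => ?_) i this
    · intro this
      rw [tau_mul_zero]
      simpa [nuVec, hb1] using this
    · intro this
      rw [tau_mul_succ, ← h1 i, ← this]
      simp [nuVec]
  · have hz : Tco n (d-1) S 0 ᵥ* B = 0 := by
      ext j
      have := rel_Tc hrel (d-1) 0 j
      have e : (S (Fin.succ 0) 0).coeff (d-1) = 1 := by
        have := congrFun hU 0
        simpa [Uco, blkU, nuVec] using this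
      rw [e, rel_u hrel 0, hb0] at this
      change (Tco n (d-1) S * B) 0 j = 0
      linear_combination this
    intro j
    rw [Matrix.eq_zero_of_vecMul_eq_zero hB hz]; rfl

end Stmt2

/-- the conjugation map `𝒮_∞ × G_r → ℳ_∞`, `(S(x), g(x)) ↦ g(x)⁻¹S(x)g(x)`,
is well defined and bijective (every element of `ℳ_∞` has exactly one preimage). -/
theorem stmt2 (n d : ℕ) (hd : 1 ≤ d) :
    (∀ S g : Matrix (Fin (n+2)) (Fin (n+2)) (Polynomial ℂ),
      MemSinf n d S → Gr n g → MemMinf n d (g⁻¹ * S * g)) ∧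
    (∀ A : Matrix (Fin (n+2)) (Fin (n+2)) (Polynomial ℂ), MemMinf n d A →
      ∃! p : Matrix (Fin (n+2)) (Fin (n+2)) (Polynomial ℂ) ×
             Matrix (Fin (n+2)) (Fin (n+2)) (Polynomial ℂ),
        MemSinf n d p.1 ∧ Gr n p.2 ∧ p.2⁻¹ * p.1 * p.2 = A) := by
  refine ⟨fun S g hS hg => Stmt2.wd hd S g hS hg, fun A hA => ?_⟩
  obtain ⟨S, g, hS, hg, h⟩ := Stmt2.exist hd hA
  refine ⟨(S, g), ⟨hS, hg, h⟩, ?_⟩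
  rintro ⟨S', g'⟩ ⟨hS', hg', h'⟩
  obtain ⟨e1, e2⟩ := Stmt2.uniq hd hA hS' hg' h' hS hg h
  exact Prod.ext e1 e2
end
end

section
/- Let A(x) ∈ M(r,d), let a, b ∈ ℂ and integers p, q ≥ 1. Let X(x) ∈ M_r(ℂ[x]) be the unique matrix with (x−a)·X(x) = [A(a)^p, A(x)], and Z(x) ∈ M_r(ℂ[x]) the unique matrix with (x−b)·Z(x) = [A(b)^q, A(x)]. Then the following identity of polynomial matrices holds: (x−a)·( [Σ_{i=0}^{q−1} A(b)^i X(b) A(b)^{q−1−i}, A(x)] + [A(b)^q, X(x)] ) = (x−b)·( [Σ_{i=0}^{p−1} A(a)^i Z(a) A(a)^{p−1−i}, A(x)] + [A(a)^p, Z(x)] ), where [M,N] = MN − NM. (This identity expresses that the vector fields Υ_a^{(p)} and Υ_b^{(q)} on M(r,d) commute.) -/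
open Polynomial Matrix

noncomputable section

/-- Telescoping: the derivation induced on powers by an inner derivation is inner. -/
theorem aux_telescope {R : Type*} [Ring R] (P B : R) (q : ℕ) :
    ∑ i ∈ Finset.range q, B ^ i * (P * B - B * P) * B ^ (q - 1 - i) = P * B ^ q - B ^ q * P := by
  have h := Finset.sum_range_sub' (fun i => B ^ i * P * B ^ (q - i)) q
  simp only [pow_zero, one_mul, Nat.sub_zero, Nat.sub_self, mul_one] at h
  rw [← h]
  refine Finset.sum_congr rfl fun i hi => ?_
  have hi := Finset.mem_range.mp hi
  obtain ⟨k, rfl⟩ : ∃ k, q = i + 1 + k := ⟨q - (i + 1), by omega⟩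
  have e1 : i + 1 + k - 1 - i = k := by omega
  have e2 : i + 1 + k - i = k + 1 := by omega
  have e3 : i + 1 + k - (i + 1) = k := by omega
  rw [e1, e2, e3, pow_succ' B k, pow_succ B i]
  noncomm_ring

theorem aux_shift {R : Type*} [Ring R] (B D : R) (p q : ℕ) :
    ∑ i ∈ Finset.range q, B ^ i * (B ^ p * D - D * B ^ p) * B ^ (q - 1 - i) =
      ∑ i ∈ Finset.range q, B ^ (p + i) * D * B ^ (p + q - 1 - (p + i)) -
      ∑ i ∈ Finset.range q, B ^ i * D * B ^ (p + q - 1 - i) := by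
  rw [← Finset.sum_sub_distrib]
  refine Finset.sum_congr rfl fun i hi => ?_
  have hi := Finset.mem_range.mp hi
  have e1 : p + q - 1 - (p + i) = q - 1 - i := by omega
  have e2 : p + q - 1 - i = p + (q - 1 - i) := by omega
  rw [e1, e2, pow_add B p (q - 1 - i), add_comm p i, pow_add]
  noncomm_ring

theorem aux_symm {R : Type*} [Ring R] (B D : R) (p q : ℕ) :
    ∑ i ∈ Finset.range q, B ^ i * (B ^ p * D - D * B ^ p) * B ^ (q - 1 - i) =
    ∑ i ∈ Finset.range p, B ^ i * (B ^ q * D - D * B ^ q) * B ^ (p - 1 - i) := by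
  rw [aux_shift, aux_shift]
  have h1 := Finset.sum_range_add (fun s => B ^ s * D * B ^ (p + q - 1 - s)) p q
  have h2 := Finset.sum_range_add (fun s => B ^ s * D * B ^ (p + q - 1 - s)) q p
  rw [add_comm q p] at h2 ⊢
  rw [h1] at h2
  rw [sub_eq_sub_iff_add_eq_add, add_comm, h2, add_comm]

/-- The final commutator computation. -/
theorem aux_final {R M : Type*} [CommRing R] [Ring M] [Algebra R M] (u v : R)
    (A P Q X Z S1 S2 : M) (hX : u • X = P * A - A * P) (hZ : v • Z = Q * A - A * Q)
    (hS : u • S1 + (Q * P - P * Q) = v • S2) :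
    u • ((S1 * A - A * S1) + (Q * X - X * Q)) = v • ((S2 * A - A * S2) + (P * Z - Z * P)) := by
  have h1 : u • ((S1 * A - A * S1) + (Q * X - X * Q)) =
      ((u • S1) * A - A * (u • S1)) + (Q * (u • X) - (u • X) * Q) := by
    simp only [smul_add, smul_sub, smul_mul_assoc, mul_smul_comm]
  have h2 : v • ((S2 * A - A * S2) + (P * Z - Z * P)) =
      ((v • S2) * A - A * (v • S2)) + (P * (v • Z) - (v • Z) * P) := by
    simp only [smul_add, smul_sub, smul_mul_assoc, mul_smul_comm]
  rw [h1, h2, hX, hZ, ← hS]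
  noncomm_ring

theorem aux_eval_C {m : Type*} (N : Matrix m m ℂ) (c : ℂ) :
    (N.map Polynomial.C).map (eval c) = N := by
  ext i j; simp

theorem aux_eval_mul {m : Type*} [Fintype m] [DecidableEq m] (M N : Matrix m m ℂ[X]) (c : ℂ) :
    (M * N).map (eval c) = M.map (eval c) * N.map (eval c) :=
  map_mul (evalRingHom c).mapMatrix M N

/-- Evaluating the defining equation of `X` at `b`. -/
theorem aux_eval {m : Type*} [Fintype m] [DecidableEq m] (A Y : Matrix m m ℂ[X])
    (P : Matrix m m ℂ) (a b : ℂ)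
    (h : (Polynomial.X - Polynomial.C a) • Y = P.map Polynomial.C * A - A * P.map Polynomial.C) :
    (b - a) • Y.map (eval b) = P * A.map (eval b) - A.map (eval b) * P := by
  have h := congrArg (fun M : Matrix m m ℂ[X] => M.map (eval b)) h
  have e : ∀ M N : Matrix m m ℂ[X], (M - N).map (eval b) = M.map (eval b) - N.map (eval b) :=
    fun M N => by ext i j; simp
  simp only [e, aux_eval_mul, aux_eval_C] at h
  rw [← h]
  ext i j; simp

/-- The diagonal case. -/
theorem aux_diag {m : Type*} [Fintype m] [DecidableEq m] (A : Matrix m m ℂ[X]) (a : ℂ) :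
    ∃ D : Matrix m m ℂ, ∀ (p : ℕ) (Y : Matrix m m ℂ[X]),
      ((Polynomial.X - Polynomial.C a) • Y = ((A.map (eval a) ^ p).map Polynomial.C) * A -
        A * ((A.map (eval a) ^ p).map Polynomial.C)) →
      Y.map (eval a) = A.map (eval a) ^ p * D - D * A.map (eval a) ^ p := by
  set D : Matrix m m ℂ[X] := A.map (fun f => f /ₘ (Polynomial.X - Polynomial.C a)) with hD
  have hA : A = (A.map (eval a)).map Polynomial.C + (Polynomial.X - Polynomial.C a) • D := by
    ext1 i j
    have := modByMonic_add_div (A i j) (Polynomial.X - Polynomial.C a)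
    rw [modByMonic_X_sub_C_eq_C_eval] at this
    simpa [hD] using this.symm
  refine ⟨D.map (eval a), fun p Y h => ?_⟩
  set B := A.map (eval a) with hB
  have hc : (B ^ p).map Polynomial.C * B.map Polynomial.C =
      B.map Polynomial.C * (B ^ p).map Polynomial.C := by
    rw [← Matrix.map_mul, ← Matrix.map_mul, ← pow_succ, ← pow_succ']
  have h3 : (Polynomial.X - Polynomial.C a) • Y = (Polynomial.X - Polynomial.C a) •
      ((B ^ p).map Polynomial.C * D - D * (B ^ p).map Polynomial.C) := by
    rw [h, hA, mul_add, add_mul, hc, add_sub_add_left_eq_sub, smul_sub, mul_smul_comm,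
      smul_mul_assoc]
  have h4 : Y = (B ^ p).map Polynomial.C * D - D * (B ^ p).map Polynomial.C := by
    ext1 i j
    have := congrFun (congrFun h3 i) j
    exact mul_left_cancel₀ (X_sub_C_ne_zero a) this
  rw [h4]
  have e : ∀ M N : Matrix m m ℂ[X], (M - N).map (eval a) = M.map (eval a) - N.map (eval a) :=
    fun M N => by ext i j; simp
  simp only [e, aux_eval_mul, aux_eval_C]

/-- commutativity of the Lax vector fields `Υ_a^{(p)}` and `Υ_b^{(q)}`. -/
theorem stmt15 (n d : ℕ) (hd : 1 ≤ d)
    (A : Matrix (Fin (n+2)) (Fin (n+2)) (Polynomial ℂ)) (hA : Mrd n d A)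
    (a b : ℂ) (p q : ℕ) (hp : 1 ≤ p) (hq : 1 ≤ q)
    (Xm Zm : Matrix (Fin (n+2)) (Fin (n+2)) (Polynomial ℂ))
    (hX : (Polynomial.X - Polynomial.C a) • Xm =
      ((A.map (eval a) ^ p).map Polynomial.C) * A -
        A * ((A.map (eval a) ^ p).map Polynomial.C))
    (hZ : (Polynomial.X - Polynomial.C b) • Zm =
      ((A.map (eval b) ^ q).map Polynomial.C) * A -
        A * ((A.map (eval b) ^ q).map Polynomial.C)) :
    let Aa : Matrix (Fin (n+2)) (Fin (n+2)) ℂ := A.map (eval a)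
    let Ab : Matrix (Fin (n+2)) (Fin (n+2)) ℂ := A.map (eval b)
    let S1 : Matrix (Fin (n+2)) (Fin (n+2)) ℂ :=
      ∑ i ∈ Finset.range q, Ab ^ i * Xm.map (eval b) * Ab ^ (q - 1 - i)
    let S2 : Matrix (Fin (n+2)) (Fin (n+2)) ℂ :=
      ∑ i ∈ Finset.range p, Aa ^ i * Zm.map (eval a) * Aa ^ (p - 1 - i)
    (Polynomial.X - Polynomial.C a) •
      ((S1.map Polynomial.C * A - A * S1.map Polynomial.C) +
        ((Ab ^ q).map Polynomial.C * Xm - Xm * (Ab ^ q).map Polynomial.C)) =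
    (Polynomial.X - Polynomial.C b) •
      ((S2.map Polynomial.C * A - A * S2.map Polynomial.C) +
        ((Aa ^ p).map Polynomial.C * Zm - Zm * (Aa ^ p).map Polynomial.C)) := by
  intro Aa Ab S1 S2
  refine aux_final _ _ A _ _ Xm Zm _ _ hX hZ ?_
  have key : (b - a) • S1 = Aa ^ p * Ab ^ q - Ab ^ q * Aa ^ p ∧ S1 = S2 := by
    have k1 : (b - a) • S1 = Aa ^ p * Ab ^ q - Ab ^ q * Aa ^ p := by
      rw [← aux_telescope, ← aux_eval A Xm (Aa ^ p) a b hX, Finset.smul_sum]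
      simp only [mul_smul_comm, smul_mul_assoc, Ab]
    have k2 : (a - b) • S2 = Ab ^ q * Aa ^ p - Aa ^ p * Ab ^ q := by
      rw [← aux_telescope, ← aux_eval A Zm (Ab ^ q) b a hZ, Finset.smul_sum]
      simp only [mul_smul_comm, smul_mul_assoc, Aa]
    refine ⟨k1, ?_⟩
    by_cases hab : a = b
    · subst hab
      obtain ⟨D, hD⟩ := aux_diag A a
      simp only [S1, S2, hD p Xm hX, hD q Zm hZ]
      exact aux_symm (A.map (eval a)) D p q
    · have hne : b - a ≠ 0 := sub_ne_zero.mpr (Ne.symm hab)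
      refine smul_right_injective _ hne ?_
      show (b - a) • S1 = (b - a) • S2
      rw [k1, ← neg_sub a b, neg_smul, k2, neg_sub]
  obtain ⟨k1, k2⟩ := key
  rw [← k2, ← Matrix.map_mul, ← Matrix.map_mul]
  ext1 i j
  have h := congrArg Polynomial.C (congrFun (congrFun k1 i) j)
  simp only [Matrix.smul_apply, Matrix.sub_apply, smul_eq_mul, map_mul, map_sub] at h
  simp only [Matrix.add_apply, Matrix.smul_apply, Matrix.sub_apply, Matrix.map_apply, smul_eq_mul]
  linear_combination h
end
end
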